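/- Let S be a nonempty finite set of positive integers with |S| even, and for each n ≥ 1 let Q_n : GaloisField 2 n → ZMod 2 be Q_n(x) = Tr(∑_{i∈S} x^(2^i+1)). Then either Q_n is unbalanced for every n ≥ 1, or there exists an integer d ≥ 1 such that for all n ≥ 1, Q_n is balanced if and only if n ≡ 2^(d−1) (mod 2^d). -/

import Mathlib

/-- The quadratic trace function `Q_n(x) = Tr(∑_{i∈S} x^(2^i+1))` on `GaloisField 2 n`. -/
noncomputable def Qtr (S : Finset ℕ) (n : ℕ) (x : GaloisField 2 n) : ZMod 2 :=
  Algebra.trace (ZMod 2) (GaloisField 2 n) (∑ i ∈ S, x ^ (2 ^ i + 1))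

/-- `g` is balanced if it takes the value `1` exactly `2^(n-1)` times. -/
noncomputable def BalancedG (n : ℕ) (g : GaloisField 2 n → ZMod 2) : Prop :=
  Nat.card {x : GaloisField 2 n // g x = 1} = 2 ^ (n - 1)

set_option linter.unusedSectionVars false
open Polynomial

/-- Balancedness of a quadratic function on a finite elementary abelian 2-group. -/
lemma balanced_iff_radical {V : Type*} [AddCommGroup V] [Finite V] (q : V → ZMod 2)
    (B : V → V →+ ZMod 2) (hq0 : q 0 = 0)
    (hB : ∀ x w, q (x + w) = q x + q w + B w x) :
    2 * Nat.card {x : V // q x = 1} = Nat.card V ↔ ∃ w, (∀ x, B w x = 0) ∧ q w = 1 := by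
  classical
  have := Fintype.ofFinite V
  let χ : ZMod 2 → ℤ := fun a => if a = 0 then 1 else -1
  have χadd : ∀ a b, χ (a + b) = χ a * χ b := by decide
  have two : ∀ a : ZMod 2, a = 0 ∨ a = 1 := by decide
  have hsum : ∑ x, χ (q x) = (Nat.card V : ℤ) - 2 * Nat.card {x : V // q x = 1} := by
    have e : ∀ x, χ (q x) = 1 - 2 * (if q x = 1 then 1 else 0) := by
      intro x
      rcases two (q x) with h | h <;> simp [χ, h]
    rw [Finset.sum_congr rfl (fun x _ => e x), Finset.sum_sub_distrib, ← Finset.mul_sum]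
    simp [Fintype.card_subtype]
  have key : 2 * Nat.card {x : V // q x = 1} = Nat.card V ↔ ∑ x, χ (q x) = 0 := by
    rw [hsum]; omega
  rw [key]
  constructor
  · intro h0
    by_contra hno
    push Not at hno
    have hsq : (∑ x, χ (q x)) * (∑ x, χ (q x)) = ∑ w, χ (q w) * ∑ x, χ (B w x) := by
      rw [Finset.sum_mul_sum]
      calc ∑ x, ∑ y, χ (q x) * χ (q y) = ∑ x, ∑ w, χ (q x) * χ (q (x + w)) := by
            refine Finset.sum_congr rfl fun x _ => ?_
            exact (Equiv.sum_comp (Equiv.addLeft x) (fun y => χ (q x) * χ (q y))).symm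
        _ = ∑ x, ∑ w, χ (q w) * χ (B w x) := by
            refine Finset.sum_congr rfl fun x _ => Finset.sum_congr rfl fun w _ => ?_
            rw [hB, ← χadd, ← χadd]
            congr 1
            have : ∀ a b c : ZMod 2, a + (a + b + c) = b + c := by decide
            exact this _ _ _
        _ = _ := by
            rw [Finset.sum_comm]
            exact Finset.sum_congr rfl fun w _ => (Finset.mul_sum ..).symm
    have hnn : ∀ w, 0 ≤ χ (q w) * ∑ x, χ (B w x) := by
      intro w
      by_cases hw : ∀ x, B w x = 0
      · have := (two (q w)).resolve_right (hno w hw)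
        simp [this, hw, χ]
      · push Not at hw
        obtain ⟨x0, hx0⟩ := hw
        have h1 := (two (B w x0)).resolve_left hx0
        have : ∑ x, χ (B w x) = - ∑ x, χ (B w x) := by
          conv_lhs => rw [← Equiv.sum_comp (Equiv.addLeft x0)]
          rw [← Finset.sum_neg_distrib]
          refine Finset.sum_congr rfl fun x _ => ?_
          simp only [Equiv.coe_addLeft, map_add, h1, χadd]
          simp only [show χ 1 = -1 from rfl, neg_mul, one_mul]
        have : ∑ x, χ (B w x) = 0 := by omega
        simp [this]
    have hpos : 0 < ∑ w, χ (q w) * ∑ x, χ (B w x) := by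
      refine Finset.sum_pos' (fun w _ => hnn w) ⟨0, Finset.mem_univ _, ?_⟩
      have hB0 : ∀ x, B 0 x = 0 := by
        intro x
        have := hB x 0
        simpa [hq0] using this
      simp [hB0, hq0, χ, Fintype.card_pos]
    rw [← hsq, h0] at hpos
    simp at hpos
  · rintro ⟨w, hw, hqw⟩
    have : ∑ x, χ (q x) = - ∑ x, χ (q x) := by
      conv_lhs => rw [← Equiv.sum_comp (Equiv.addRight w)]
      rw [← Finset.sum_neg_distrib]
      refine Finset.sum_congr rfl fun x _ => ?_
      simp only [Equiv.coe_addRight, hB, hw, hqw, χadd]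
      simp [χ]
    omega

section
variable (F : Type*) [Field F] [Finite F] [Algebra (ZMod 2) F]

noncomputable def sg : F →ₐ[ZMod 2] F := FiniteField.frobeniusAlgHom (ZMod 2) F

noncomputable def sgl : Module.End (ZMod 2) F := (sg F).toLinearMap

noncomputable def tr : F →ₗ[ZMod 2] ZMod 2 := Algebra.trace (ZMod 2) F

variable {F}
lemma sgl_apply (x : F) : sgl F x = x ^ 2 := by
  simp [sgl, sg, FiniteField.frobeniusAlgHom_apply]

lemma sgl_pow_apply (i : ℕ) (x : F) : (sgl F ^ i) x = x ^ 2 ^ i := by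
  induction i with
  | zero => simp
  | succ i ih => rw [pow_succ', Module.End.mul_apply, ih, sgl_apply, ← pow_mul, pow_succ]

lemma sgl_mul (i : ℕ) (x y : F) : (sgl F ^ i) (x * y) = (sgl F ^ i) x * (sgl F ^ i) y := by
  simp only [sgl_pow_apply, mul_pow]

lemma tr_sum (x : F) : algebraMap (ZMod 2) F (tr F x) =
    ∑ i ∈ Finset.range (Module.finrank (ZMod 2) F), (sgl F ^ i) x := by
  rw [tr, FiniteField.algebraMap_trace_eq_sum_pow]
  simp [sgl_pow_apply]

lemma sgl_finrank : sgl F ^ (Module.finrank (ZMod 2) F) = 1 := by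
  ext x
  rw [sgl_pow_apply, FiniteField.pow_finrank_eq_natCard]
  have := Fintype.ofFinite F
  simp [FiniteField.pow_card]

lemma tr_sgl (x : F) : tr F (sgl F x) = tr F x := by
  apply (algebraMap (ZMod 2) F).injective
  have h1 : (1 : ℕ) ≤ Module.finrank (ZMod 2) F := Module.finrank_pos
  rw [tr_sum, tr_sum]
  have e : ∀ i, (sgl F ^ i) (sgl F x) = (sgl F ^ (i+1)) x := fun i => by
    rw [pow_succ, Module.End.mul_apply]
  simp only [e]
  have := Finset.sum_range_succ' (fun i => (sgl F ^ i) x) (Module.finrank (ZMod 2) F)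
  rw [Finset.sum_range_succ, sgl_finrank, pow_zero] at this
  exact (add_right_cancel this).symm

lemma tr_sgl_pow (i : ℕ) (x : F) : tr F ((sgl F ^ i) x) = tr F x := by
  induction i with
  | zero => simp
  | succ i ih => rw [pow_succ', Module.End.mul_apply, tr_sgl, ih]

lemma two_F : (2 : F) = 0 := by
  have h : (2 : ZMod 2) = 0 := rfl
  have := congrArg (algebraMap (ZMod 2) F) h
  rwa [map_ofNat, map_zero] at this

/-- An element of the index-two subfield has trace zero. -/
lemma tr_half (M : ℕ) (hM : Module.finrank (ZMod 2) F = 2 * M) (y : F) (hy : (sgl F ^ M) y = y) :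
    tr F y = 0 := by
  apply (algebraMap (ZMod 2) F).injective
  rw [tr_sum, hM, two_mul, Finset.sum_range_add]
  have : ∀ i, (sgl F ^ (M + i)) y = (sgl F ^ i) y := fun i => by
    rw [add_comm, pow_add, Module.End.mul_apply, hy]
  simp only [this, map_zero]
  rw [← two_mul, two_F, zero_mul]

noncomputable def qf (S : Finset ℕ) (x : F) : ZMod 2 := ∑ i ∈ S, tr F (x * (sgl F ^ i) x)

lemma qf_eq (S : Finset ℕ) (x : F) :
    Algebra.trace (ZMod 2) F (∑ i ∈ S, x ^ (2 ^ i + 1)) = qf S x := by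
  rw [map_sum, qf]
  refine Finset.sum_congr rfl fun i _ => ?_
  rw [sgl_pow_apply, tr, pow_succ']

noncomputable def PP (S : Finset ℕ) (K : ℕ) : (ZMod 2)[X] := ∑ i ∈ S, (X ^ (K + i) + X ^ (K - i))

noncomputable def LL (S : Finset ℕ) (K : ℕ) : Module.End (ZMod 2) F := aeval (sgl F) (PP S K)

lemma sgl_inj : Function.Injective (sgl F) := by
  exact (sg F).toRingHom.injective

lemma sgl_pow_inj (K : ℕ) : Function.Injective (sgl F ^ K) := by
  rw [Module.End.coe_pow]
  exact sgl_inj.iterate K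

/-- the polar form -/
noncomputable def bil (S : Finset ℕ) (K : ℕ) (w : F) : F →+ ZMod 2 :=
  ((tr F).comp ((LinearMap.mulRight (ZMod 2) (LL S K w)).comp (sgl F ^ K))).toAddMonoidHom

lemma bil_apply (S : Finset ℕ) (K : ℕ) (w x : F) :
    bil S K w x = tr F ((sgl F ^ K) x * LL S K w) := rfl

lemma qf_add (S : Finset ℕ) (K : ℕ) (hK : ∀ i ∈ S, i ≤ K) (x w : F) :
    qf S (x + w) = qf S x + qf S w + bil S K w x := by
  rw [bil_apply, LL, PP, map_sum, LinearMap.sum_apply, Finset.mul_sum, map_sum, qf, qf, qf,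
    ← Finset.sum_add_distrib, ← Finset.sum_add_distrib]
  refine Finset.sum_congr rfl fun i hi => ?_
  have h1 : tr F ((sgl F ^ K) x * (sgl F ^ (K + i)) w) = tr F (x * (sgl F ^ i) w) := by
    rw [pow_add, Module.End.mul_apply, ← sgl_mul, tr_sgl_pow]
  have h2 : tr F ((sgl F ^ K) x * (sgl F ^ (K - i)) w) = tr F (w * (sgl F ^ i) x) := by
    have : K = (K - i) + i := (Nat.sub_add_cancel (hK i hi)).symm
    conv_lhs => rw [this]
    rw [Nat.add_sub_cancel, pow_add, Module.End.mul_apply, ← sgl_mul, tr_sgl_pow, mul_comm]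
  simp only [map_add, map_pow, aeval_X, LinearMap.add_apply, mul_add, add_mul, h1, h2]
  ring

lemma bil_zero_iff (S : Finset ℕ) (K : ℕ) (w : F) :
    (∀ x, bil S K w x = 0) ↔ LL S K w = 0 := by
  constructor
  · intro h
    have hs : Function.Surjective (sgl F ^ K) := Finite.surjective_of_injective (sgl_pow_inj K)
    apply (traceForm_nondegenerate (ZMod 2) F).1
    intro y
    obtain ⟨x, rfl⟩ := hs y
    rw [Algebra.traceForm_apply, mul_comm]
    exact h x
  · intro h x
    rw [bil_apply, h, mul_zero, map_zero]

lemma qf_balanced_iff (S : Finset ℕ) (K : ℕ) (hK : ∀ i ∈ S, i ≤ K) :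
    2 * Nat.card {x : F // qf S x = 1} = Nat.card F ↔ ∃ w : F, LL S K w = 0 ∧ qf S w = 1 := by
  have h0 : qf S (0 : F) = 0 := by
    unfold qf
    exact Finset.sum_eq_zero fun i _ => by rw [zero_mul, map_zero]
  have := balanced_iff_radical (V := F) (qf S) (bil S K) h0 (qf_add S K hK)
  rw [this]
  exact exists_congr fun w => and_congr_left fun _ => bil_zero_iff S K w

lemma qf_sgl (S : Finset ℕ) (x : F) : qf S (sgl F x) = qf S x := by
  unfold qf
  refine Finset.sum_congr rfl fun i _ => ?_
  rw [← tr_sgl (x * _)]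
  congr 1
  have := sgl_mul 1 x ((sgl F ^ i) x)
  rw [pow_one] at this
  rw [this, ← Module.End.mul_apply, ← Module.End.mul_apply, ← pow_succ, ← pow_succ']

/-- `(X+1)` times a radical element has value zero -/
lemma qf_t (S : Finset ℕ) (K : ℕ) (hK : ∀ i ∈ S, i ≤ K) (y : F) (hy : LL S K y = 0) :
    qf S (aeval (sgl F) (X + 1 : (ZMod 2)[X]) y) = 0 := by
  have : aeval (sgl F) (X + 1 : (ZMod 2)[X]) y = sgl F y + y := by simp
  rw [this, qf_add S K hK, qf_sgl, bil_apply, hy, mul_zero, map_zero, add_zero]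
  exact CharTwo.add_self_eq_zero _

lemma LL_comm (S : Finset ℕ) (K : ℕ) (f : (ZMod 2)[X]) (y : F) (hy : LL S K y = 0) :
    LL S K (aeval (sgl F) f y) = 0 := by
  rw [LL, ← Module.End.mul_apply, ← map_mul, mul_comm, map_mul, Module.End.mul_apply]
  rw [LL] at hy
  rw [hy, map_zero]

lemma t_pow (k : ℕ) : (X + 1 : (ZMod 2)[X]) ^ 2 ^ k = X ^ 2 ^ k + 1 := by
  rw [add_pow_char_pow, one_pow]

/-- reduce to the subfield fixed by `σ^(2^k)` -/
lemma reduce (S : Finset ℕ) (K k m : ℕ) (hK : ∀ i ∈ S, i ≤ K) (hm : Odd m)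
    (hn : Module.finrank (ZMod 2) F = 2 ^ k * m) (w : F) (hw : LL S K w = 0) :
    ∃ y : F, LL S K y = 0 ∧ qf S y = qf S w ∧ (sgl F ^ 2 ^ k) y = y := by
  -- `X^m + 1 = (X+1) u`
  obtain ⟨u, hu, hu1⟩ : ∃ u : (ZMod 2)[X], X ^ m - 1 = u * (X - 1) ∧ eval 1 u = 1 := by
    refine ⟨∑ i ∈ Finset.range m, X ^ i, (geom_sum_mul X m).symm, ?_⟩
    simp [eval_finsetSum]
    obtain ⟨r, rfl⟩ := hm
    push_cast
    rw [show (2 : ZMod 2) = 0 from rfl]; simp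
  have h11 : (X - 1 : (ZMod 2)[X]) = X + 1 := CharTwo.sub_eq_add _ _
  have hcop : IsCoprime (u ^ 2 ^ k) ((X + 1 : (ZMod 2)[X]) ^ 2 ^ k) := by
    apply IsCoprime.pow
    rw [← h11, ← C_1]
    apply IsCoprime.symm
    rw [(irreducible_X_sub_C (1 : ZMod 2)).coprime_iff_not_dvd, dvd_iff_isRoot, IsRoot, hu1]
    exact one_ne_zero
  obtain ⟨a, b, hab⟩ := hcop
  have hkill : aeval (sgl F) ((X + 1 : (ZMod 2)[X]) ^ 2 ^ k * u ^ 2 ^ k) = 0 := by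
    rw [← mul_pow, ← h11, mul_comm, ← hu, sub_pow_char_pow, ← pow_mul, mul_comm m, one_pow,
      map_sub, map_pow, aeval_X, ← hn, sgl_finrank, map_one, sub_self]
  refine ⟨aeval (sgl F) (a * u ^ 2 ^ k) w, LL_comm _ _ _ _ hw, ?_, ?_⟩
  · have hpos : 2 ^ k = (2 ^ k - 1) + 1 := (Nat.sub_add_cancel Nat.one_le_two_pow).symm
    have e : w = aeval (sgl F) (a * u ^ 2 ^ k) w +
        aeval (sgl F) (X + 1 : (ZMod 2)[X]) (aeval (sgl F) (b * (X + 1) ^ (2 ^ k - 1)) w) := by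
      rw [← Module.End.mul_apply, ← map_mul, ← LinearMap.add_apply, ← map_add]
      have : a * u ^ 2 ^ k + (X + 1) * (b * (X + 1) ^ (2 ^ k - 1)) = 1 := by
        refine Eq.trans ?_ hab
        congr 1
        conv_rhs => rw [hpos]
        ring
      rw [this, map_one, Module.End.one_apply]
    conv_rhs => rw [e]
    rw [qf_add S K hK, qf_t S K hK _ (LL_comm _ _ _ _ hw), bil_apply,
      LL_comm S K _ _ (LL_comm S K _ _ hw)]
    simp
  · have : aeval (sgl F) (X ^ 2 ^ k + 1 : (ZMod 2)[X]) (aeval (sgl F) (a * u ^ 2 ^ k) w) = 0 := by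
      rw [← t_pow, ← Module.End.mul_apply, ← map_mul,
        show (X + 1 : (ZMod 2)[X]) ^ 2 ^ k * (a * u ^ 2 ^ k) = a * ((X + 1) ^ 2 ^ k * u ^ 2 ^ k) by
          ring, map_mul, hkill, mul_zero, LinearMap.zero_apply]
    simp only [map_add, map_pow, aeval_X, map_one, LinearMap.add_apply, Module.End.one_apply]
      at this
    have h3 := add_eq_zero_iff_eq_neg.mp this
    rw [h3, neg_eq_iff_add_eq_zero, ← two_mul, two_F, zero_mul]
end

section
variable {E F : Type*} [Field F] [Finite F] [Algebra (ZMod 2) F]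
  [Field E] [Finite E] [Algebra (ZMod 2) E]

lemma map_sgl_pow (φ : E →ₐ[ZMod 2] F) (i : ℕ) (x : E) :
    φ ((sgl E ^ i) x) = (sgl F ^ i) (φ x) := by
  rw [sgl_pow_apply, sgl_pow_apply, map_pow]

lemma map_LL (φ : E →ₐ[ZMod 2] F) (S : Finset ℕ) (K : ℕ) (x : E) :
    φ (LL S K x) = LL S K (φ x) := by
  simp only [LL, PP, map_sum, LinearMap.sum_apply, map_add, map_pow, aeval_X, LinearMap.add_apply,
    map_sgl_pow]

lemma tr_map (φ : E →ₐ[ZMod 2] F) (m : ℕ) (hm : Odd m)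
    (h : Module.finrank (ZMod 2) F = Module.finrank (ZMod 2) E * m) (x : E) :
    tr F (φ x) = tr E x := by
  algebraize [φ.toRingHom]
  have hf := Module.finrank_mul_finrank (ZMod 2) E F
  have hm' : Module.finrank E F = m := by
    rw [h] at hf
    exact Nat.eq_of_mul_eq_mul_left Module.finrank_pos hf
  have : φ x = algebraMap E F x := rfl
  rw [tr, tr, this, ← Algebra.trace_trace (S := E), Algebra.trace_algebraMap, hm', map_nsmul]
  obtain ⟨r, rfl⟩ := hm
  rw [nsmul_eq_mul]
  push_cast
  rw [show (2 : ZMod 2) = 0 from rfl]; simp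

lemma qf_map (φ : E →ₐ[ZMod 2] F) (m : ℕ) (hm : Odd m)
    (h : Module.finrank (ZMod 2) F = Module.finrank (ZMod 2) E * m) (S : Finset ℕ) (x : E) :
    qf S (φ x) = qf S x := by
  unfold qf
  refine Finset.sum_congr rfl fun i _ => ?_
  rw [← map_sgl_pow, ← map_mul, tr_map φ m hm h]

lemma fixed_range (φ : E →ₐ[ZMod 2] F) (y : F)
    (hy : (sgl F ^ (Module.finrank (ZMod 2) E)) y = y) : ∃ x, φ x = y := by
  algebraize [φ.toRingHom]
  have := Fintype.ofFinite E
  have : y ∈ (⊥ : IntermediateField E F) := by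
    rw [IsGalois.mem_bot_iff_fixed]
    intro f
    obtain ⟨n, rfl⟩ := (FiniteField.bijective_frobeniusAlgEquivOfAlgebraic_pow E F).2 f
    have h1 : FiniteField.frobeniusAlgEquivOfAlgebraic E F y = y := by
      rw [FiniteField.coe_frobeniusAlgEquivOfAlgebraic]
      rw [sgl_pow_apply, FiniteField.pow_finrank_eq_card] at hy
      exact hy
    rw [AlgEquiv.coe_pow]
    exact Function.iterate_fixed h1 _
  rw [IntermediateField.mem_bot] at this
  exact this

lemma transfer (S : Finset ℕ) (K k m : ℕ) (hK : ∀ i ∈ S, i ≤ K) (hm : Odd m)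
    (hE : Module.finrank (ZMod 2) E = 2 ^ k) (hF : Module.finrank (ZMod 2) F = 2 ^ k * m) :
    (∃ w : F, LL S K w = 0 ∧ qf S w = 1) ↔ ∃ w : E, LL S K w = 0 ∧ qf S w = 1 := by
  obtain ⟨φ⟩ : Nonempty (E →ₐ[ZMod 2] F) :=
    FiniteField.nonempty_algHom_of_finrank_dvd (by rw [hE, hF]; exact dvd_mul_right _ _)
  have hEF : Module.finrank (ZMod 2) F = Module.finrank (ZMod 2) E * m := by rw [hF, hE]
  constructor
  · rintro ⟨w, hw, hq⟩
    obtain ⟨y, hy, hqy, hfix⟩ := reduce S K k m hK hm hF w hw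
    rw [← hE] at hfix
    obtain ⟨x, rfl⟩ := fixed_range φ y hfix
    refine ⟨x, φ.toRingHom.injective ?_, ?_⟩
    · rw [← map_LL] at hy
      rw [map_zero]
      exact hy
    · rw [← qf_map φ m hm hEF, hqy, hq]
  · rintro ⟨w, hw, hq⟩
    refine ⟨φ w, ?_, ?_⟩
    · rw [← map_LL, hw, map_zero]
    · rw [qf_map φ m hm hEF, hq]

/-- If `2 v ≤ 2^k`, the function is not balanced. -/
lemma not_large (S : Finset ℕ) (K k v : ℕ) (hv1 : 1 ≤ v) (hv : 2 * v ≤ 2 ^ k) (h : (ZMod 2)[X])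
    (hP : PP S K = (X + 1) ^ v * h) (hh : ¬ (X + 1) ∣ h)
    (hF : Module.finrank (ZMod 2) F = 2 ^ k) (w : F) (hw : LL S K w = 0) : qf S w = 0 := by
  obtain ⟨l, rfl⟩ : ∃ l, k = l + 1 := by
    cases k with
    | zero => omega
    | succ l => exact ⟨l, rfl⟩
  have h11 : (X - 1 : (ZMod 2)[X]) = X + 1 := CharTwo.sub_eq_add _ _
  have hcop : IsCoprime h ((X + 1 : (ZMod 2)[X]) ^ 2 ^ (l + 1)) := by
    apply IsCoprime.pow_right
    apply IsCoprime.symm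
    rw [← h11, ← C_1] at hh ⊢
    rwa [(irreducible_X_sub_C (1 : ZMod 2)).coprime_iff_not_dvd]
  obtain ⟨a, b, hab⟩ := hcop
  have hkill : aeval (sgl F) ((X + 1 : (ZMod 2)[X]) ^ 2 ^ (l + 1)) = 0 := by
    rw [← h11, sub_pow_char_pow, one_pow, map_sub, map_pow, aeval_X, ← hF, sgl_finrank, map_one,
      sub_self]
  have e : (X + 1 : (ZMod 2)[X]) ^ 2 ^ l = (X + 1) ^ (2 ^ l - v) * a * PP S K +
      (b * (X + 1) ^ 2 ^ l) * (X + 1) ^ 2 ^ (l + 1) := by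
    have hle : v ≤ 2 ^ l := by rw [pow_succ] at hv; omega
    have h3 : (X + 1 : (ZMod 2)[X]) ^ 2 ^ l = (X + 1) ^ (2 ^ l - v) * (X + 1) ^ v := by
      rw [← pow_add, Nat.sub_add_cancel hle]
    rw [hP]
    linear_combination (-(X + 1 : (ZMod 2)[X]) ^ 2 ^ l) * hab + a * h * h3
  have hfix0 : aeval (sgl F) ((X + 1 : (ZMod 2)[X]) ^ 2 ^ l) w = 0 := by
    rw [e, map_add, map_mul _ _ ((X + 1 : (ZMod 2)[X]) ^ 2 ^ (l + 1)), hkill, mul_zero, add_zero,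
      map_mul, Module.End.mul_apply]
    rw [LL] at hw
    rw [hw, map_zero]
  have hfix : (sgl F ^ 2 ^ l) w = w := by
    rw [t_pow] at hfix0
    simp only [map_add, map_pow, aeval_X, map_one, LinearMap.add_apply, Module.End.one_apply]
      at hfix0
    rw [add_eq_zero_iff_eq_neg.mp hfix0, neg_eq_iff_add_eq_zero, ← two_mul, two_F, zero_mul]
  unfold qf
  refine Finset.sum_eq_zero fun i _ => ?_
  apply tr_half (2 ^ l) (by rw [hF, pow_succ, mul_comm])
  rw [sgl_mul, hfix, ← Module.End.mul_apply, ← pow_add, add_comm, pow_add, Module.End.mul_apply,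
    hfix]

lemma functional (S : Finset ℕ) (K N : ℕ) (hK : ∀ i ∈ S, i ≤ K) (h : (ZMod 2)[X])
    (hP : PP S K = (X + 1) * (X ^ N + 1) * h) (β : ℤ → ZMod 2) (c : ZMod 2)
    (hβ : ∀ j, β (j + N) = β j + c) : ∑ i ∈ S, (β i + β (-i)) = 0 := by
  let Λ : (ZMod 2)[X] →ₗ[ZMod 2] ZMod 2 :=
    Polynomial.lsum (fun j => LinearMap.toSpanSingleton (ZMod 2) (ZMod 2) (β ((j : ℤ) - K)))
  have hΛ : ∀ j : ℕ, Λ (X ^ j) = β ((j : ℤ) - K) := by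
    intro j
    rw [X_pow_eq_monomial]
    simp [Λ, Polynomial.lsum_apply, Polynomial.sum_monomial_index]
  have h1 : Λ (PP S K) = ∑ i ∈ S, (β i + β (-i)) := by
    rw [PP, map_sum]
    refine Finset.sum_congr rfl fun i hi => ?_
    rw [map_add, hΛ, hΛ, Nat.cast_sub (hK i hi)]
    congr 2
    · push_cast; ring
    · ring
  have h2 : ∀ f : (ZMod 2)[X], Λ ((X + 1) * (X ^ N + 1) * f) = 0 := by
    intro f
    induction f using Polynomial.induction_on' with
    | add p q hp hq => rw [mul_add, map_add, hp, hq, add_zero]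
    | monomial n a =>
      rw [← C_mul_X_pow_eq_monomial, mul_left_comm, ← smul_eq_C_mul, map_smul]
      have : ((X + 1) * (X ^ N + 1) * X ^ n : (ZMod 2)[X]) =
        X ^ (n + 1 + N) + X ^ (n + N) + X ^ (n + 1) + X ^ n := by ring
      rw [this, map_add, map_add, map_add, hΛ, hΛ, hΛ, hΛ]
      have e1 : ((n + 1 + N : ℕ) : ℤ) - K = (((n + 1 : ℕ) : ℤ) - K) + N := by push_cast; ring
      have e2 : ((n + N : ℕ) : ℤ) - K = ((n : ℤ) - K) + N := by push_cast; ring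
      rw [e1, e2, hβ, hβ]
      have : ∀ x y c : ZMod 2, x + c + (y + c) + x + y = 0 := by decide
      rw [this, smul_zero]
  rw [← h1, hP, h2]

/-- If `2^k < v`, the function is not balanced. -/
lemma not_small (S : Finset ℕ) (K k : ℕ) (hK : ∀ i ∈ S, i ≤ K) (heven : Even S.card)
    (h : (ZMod 2)[X]) (hP : PP S K = (X + 1) * (X ^ (2 ^ k) + 1) * h)
    (hF : Module.finrank (ZMod 2) F = 2 ^ k) (w : F) : qf S w = 0 := by
  set N : ℕ := 2 ^ k with hN
  have hNpos : 0 < N := by positivity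
  let b : ℕ → ZMod 2 := fun i => tr F (w * (sgl F ^ i) w)
  have hsN : sgl F ^ N = 1 := by rw [← hF]; exact sgl_finrank
  have hbmod : ∀ i, b i = b (i % N) := by
    intro i
    have : sgl F ^ i = sgl F ^ (i % N) := by
      conv_lhs => rw [← Nat.div_add_mod i N, pow_add, pow_mul, hsN, one_pow, one_mul]
    simp only [b, this]
  have hbsymm : ∀ r, r ≤ N → b (N - r) = b r := by
    intro r hr
    simp only [b]
    rw [← tr_sgl_pow r, sgl_mul, ← Module.End.mul_apply, ← pow_add, Nat.add_sub_cancel' hr, hsN,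
      Module.End.one_apply, mul_comm]
  have hbhalf : ∀ r, 2 * r = N → b r = 0 := by
    intro r hr
    apply tr_half r (by rw [hF, hr])
    rw [sgl_mul, ← Module.End.mul_apply, ← pow_add, ← two_mul, hr, hsN, Module.End.one_apply,
      mul_comm]
  let c : ℤ → ZMod 2 := fun r => if 0 < r ∧ 2 * r < N then b r.toNat else 0
  let β : ℤ → ZMod 2 := fun j => c (j % N) + b 0 * ((j / N : ℤ) : ZMod 2)
  have hNz : (N : ℤ) ≠ 0 := by omega
  have hβ : ∀ j, β (j + N) = β j + b 0 := by
    intro j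
    simp only [β]
    rw [Int.add_emod_right, Int.add_ediv_of_dvd_right (dvd_refl _), Int.ediv_self hNz]
    push_cast
    ring
  have hsum := functional S K N hK h hP β (b 0) hβ
  have hterm : ∀ i : ℕ, β i + β (-i) = b i + b 0 := by
    intro i
    have c2 : ∀ x : ZMod 2, x + x = 0 := by decide
    have hdm := Nat.div_add_mod i N
    have hlt := Nat.mod_lt i hNpos
    rw [hbmod i]
    generalize i % N = r at *
    generalize i / N = q at *
    have hi : (i : ℤ) = r + N * q := by rw [← hdm]; push_cast; ring
    rw [hi]
    have m1 : ((r : ℤ) + N * q) % N = r := by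
      rw [Int.add_mul_emod_self_left]; exact Int.emod_eq_of_lt (by omega) (by omega)
    have d1 : ((r : ℤ) + N * q) / N = q := by
      rw [Int.add_mul_ediv_left _ _ hNz, Int.ediv_eq_zero_of_lt (by omega) (by omega), zero_add]
    simp only [β, m1, d1]
    rcases Nat.eq_zero_or_pos r with rfl | hr
    · have m2 : (-(((0 : ℕ) : ℤ) + N * q)) % N = 0 := by
        rw [show (-(((0 : ℕ) : ℤ) + N * q)) = N * (-q) by push_cast; ring]
        exact Int.mul_emod_right _ _
      have d2 : (-(((0 : ℕ) : ℤ) + N * q)) / N = -q := by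
        rw [show (-(((0 : ℕ) : ℤ) + N * q)) = N * (-q) by push_cast; ring]
        exact Int.mul_ediv_cancel_left _ hNz
      rw [m2, d2]
      simp [c, c2]
    · have e : (-((r : ℤ) + N * q)) = ((N - r : ℕ) : ℤ) + N * (-q - 1) := by
        rw [Nat.cast_sub hlt.le]; ring
      have m2 : (-((r : ℤ) + N * q)) % N = ((N - r : ℕ) : ℤ) := by
        rw [e, Int.add_mul_emod_self_left]; exact Int.emod_eq_of_lt (by omega) (by omega)
      have d2 : (-((r : ℤ) + N * q)) / N = -q - 1 := by
        rw [e, Int.add_mul_ediv_left _ _ hNz, Int.ediv_eq_zero_of_lt (by omega) (by omega),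
          zero_add]
      rw [m2, d2]
      have hc : c r + c ((N - r : ℕ) : ℤ) = b r := by
        simp only [c, Int.toNat_natCast, hbsymm r hlt.le]
        rcases lt_trichotomy (2 * r) N with h1 | h1 | h1
        · rw [if_pos (by omega), if_neg (by omega), add_zero]
        · rw [if_neg (by omega), if_neg (by omega), add_zero, hbhalf r h1]
        · rw [if_neg (by omega), if_pos (by omega), zero_add]
      rw [← hc]
      push_cast
      have : (-1 : ZMod 2) = 1 := by decide
      linear_combination (b 0) * this
  simp only [hterm, Finset.sum_add_distrib, Finset.sum_const] at hsum
  obtain ⟨r, hr⟩ := heven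
  have c3 : ∀ x : ZMod 2, r • x + r • x = 0 := by
    intro x
    have c2 : ∀ x : ZMod 2, x + x = 0 := by decide
    exact c2 _
  rw [hr, add_nsmul, c3, add_zero] at hsum
  exact hsum
end

lemma PP_ne_zero (S : Finset ℕ) (K : ℕ) (hS : S.Nonempty) (hpos : ∀ i ∈ S, 1 ≤ i) :
    PP S K ≠ 0 := by
  obtain ⟨i0, hi0⟩ := hS
  intro h
  have h1 := congrArg (fun p => coeff p (K + i0)) h
  simp only [PP, finsetSum_coeff, coeff_add, coeff_X_pow, coeff_zero] at h1
  rw [Finset.sum_eq_single i0] at h1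
  · have := hpos i0 hi0
    rw [if_pos rfl, if_neg (by omega)] at h1
    simp at h1
  · intro i hi hne
    have := hpos i0 hi0
    rw [if_neg (by omega), if_neg (by omega), add_zero]
  · intro h; exact absurd hi0 h

/-- For an even number of terms, either `Q_n` is never balanced, or it is balanced
exactly when `n ≡ 2^(d-1) (mod 2^d)` for some fixed `d`. -/
theorem even_terms_balanced_dichotomy (S : Finset ℕ) (hS : S.Nonempty)
    (hpos : ∀ i ∈ S, 1 ≤ i) (heven : Even S.card) :
    (∀ n, 1 ≤ n → ¬ BalancedG n (Qtr S n)) ∨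
    (∃ d : ℕ, 1 ≤ d ∧ ∀ n, 1 ≤ n →
      (BalancedG n (Qtr S n) ↔ n % 2 ^ d = 2 ^ (d - 1))) := by
  obtain ⟨K, hK⟩ : ∃ K, ∀ i ∈ S, i ≤ K := ⟨S.sup id, fun i hi => Finset.le_sup (f := id) hi⟩
  obtain ⟨h, hP, hh⟩ := (PP S K).exists_eq_pow_rootMultiplicity_mul_and_not_dvd
    (PP_ne_zero S K hS hpos) 1
  generalize rootMultiplicity 1 (PP S K) = v at hP
  have h11 : (X - C 1 : (ZMod 2)[X]) = X + 1 := by rw [C_1]; exact CharTwo.sub_eq_add _ _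
  rw [h11] at hP hh
  have hv1 : 1 ≤ v := by
    by_contra hv
    have hv0 : v = 0 := by omega
    rw [hv0, pow_zero, one_mul] at hP
    rw [← hP, ← h11, dvd_iff_isRoot] at hh
    apply hh
    simp only [IsRoot, PP, eval_finsetSum, eval_add, eval_pow, eval_X, one_pow]
    exact Finset.sum_eq_zero fun _ _ => rfl
  let Good : ℕ → Prop := fun k => ∃ w : GaloisField 2 (2 ^ k), LL S K w = 0 ∧ qf S w = 1
  have hgood : ∀ k m, Odd m → (BalancedG (2 ^ k * m) (Qtr S (2 ^ k * m)) ↔ Good k) := by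
    intro k m hm
    have hn0 : 2 ^ k * m ≠ 0 := by
      obtain ⟨r, rfl⟩ := hm
      positivity
    have hq : ∀ x, Qtr S (2 ^ k * m) x = qf S x := fun x => qf_eq S x
    have h2 : 2 ^ (2 ^ k * m) = 2 * 2 ^ (2 ^ k * m - 1) := by
      rw [← pow_succ', Nat.sub_add_cancel (Nat.one_le_iff_ne_zero.mpr hn0)]
    change _ ↔ ∃ w : GaloisField 2 (2 ^ k), LL S K w = 0 ∧ qf S w = 1
    rw [← transfer (F := GaloisField 2 (2 ^ k * m)) S K k m hK hm
      (GaloisField.finrank 2 (by positivity)) (GaloisField.finrank 2 hn0),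
      ← qf_balanced_iff S K hK, GaloisField.card 2 _ hn0, BalancedG]
    simp only [hq]
    omega
  have hrange : ∀ k, Good k → v ≤ 2 ^ k ∧ 2 ^ k < 2 * v := by
    rintro k ⟨w, hw, hq⟩
    have hF : Module.finrank (ZMod 2) (GaloisField 2 (2 ^ k)) = 2 ^ k :=
      GaloisField.finrank 2 (by positivity)
    constructor
    · by_contra hlt
      push Not at hlt
      have : qf S w = 0 := by
        refine not_small S K k hK heven ((X + 1) ^ (v - (2 ^ k + 1)) * h) ?_ hF w
        rw [hP, ← t_pow, ← pow_succ', ← mul_assoc, ← pow_add, Nat.add_sub_cancel' hlt]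
      rw [this] at hq
      exact zero_ne_one hq
    · by_contra hlt
      push Not at hlt
      have := not_large S K k v hv1 hlt h hP hh hF w hw
      rw [this] at hq
      exact zero_ne_one hq
  have huniq : ∀ k l, Good k → Good l → k ≤ l := by
    intro k l hk hl
    have h1 := hrange k hk
    have h2 := hrange l hl
    have : 2 ^ k < 2 ^ (l + 1) := by rw [pow_succ]; omega
    exact Nat.lt_succ_iff.mp ((Nat.pow_lt_pow_iff_right (by norm_num)).mp this)
  by_cases hex : ∃ k, Good k
  · right
    obtain ⟨k, hk⟩ := hex
    refine ⟨k + 1, by omega, fun n hn => ?_⟩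
    obtain ⟨l, m, hm, rfl⟩ := Nat.exists_eq_two_pow_mul_odd (n := n) (by omega)
    rw [hgood l m hm, Nat.add_sub_cancel]
    have hmod : ∀ r, (2 ^ k * (2 * r + 1)) % 2 ^ (k + 1) = 2 ^ k := by
      intro r
      rw [show 2 ^ k * (2 * r + 1) = 2 ^ k + 2 ^ (k + 1) * r by ring, Nat.add_mul_mod_self_left]
      exact Nat.mod_eq_of_lt (Nat.pow_lt_pow_right (by norm_num) (by omega))
    constructor
    · intro hl
      obtain rfl : k = l := le_antisymm (huniq _ _ hk hl) (huniq _ _ hl hk)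
      obtain ⟨r, rfl⟩ := hm
      exact hmod r
    · intro hmd
      have hkl : k = l := by
        have hform : 2 ^ l * m = 2 ^ k * (2 * (2 ^ l * m / 2 ^ (k + 1)) + 1) := by
          have := Nat.div_add_mod (2 ^ l * m) (2 ^ (k + 1))
          rw [hmd] at this
          conv_lhs => rw [← this]
          ring
        generalize 2 ^ l * m / 2 ^ (k + 1) = r at hform
        have hodd : Odd (2 * r + 1) := ⟨r, rfl⟩
        rcases lt_trichotomy l k with hlt | heq | hlt
        · obtain ⟨e, rfl⟩ := Nat.exists_eq_add_of_lt hlt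
          rw [show 2 ^ (l + e + 1) * (2 * r + 1) = 2 ^ l * (2 * (2 ^ e * (2 * r + 1))) by ring]
            at hform
          have := Nat.eq_of_mul_eq_mul_left (by positivity) hform
          obtain ⟨s, rfl⟩ := hm
          omega
        · exact heq.symm
        · obtain ⟨e, rfl⟩ := Nat.exists_eq_add_of_lt hlt
          rw [show 2 ^ (k + e + 1) * m = 2 ^ k * (2 * (2 ^ e * m)) by ring] at hform
          have := Nat.eq_of_mul_eq_mul_left (by positivity) hform
          omega
      rwa [← hkl]
  · left
    intro n hn hb
    obtain ⟨l, m, hm, rfl⟩ := Nat.exists_eq_two_pow_mul_odd (n := n) (by omega)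
    exact hex ⟨l, (hgood l m hm).mp hb⟩
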